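/- Every drift inducing feature is strongly drift inducing if and only if every weakly drifting feature is faithfully drifting: (for all i ∈ Fin d, if i belongs to some minimal drift inducing set then i belongs to every drift inducing set) if and only if (for all i ∈ Fin d, if i is drifting but not strongly drifting then i belongs to no minimal drift inducing set). -/

import Mathlib

open MeasureTheory ProbabilityTheory

/-- The restriction of the feature vector `X` to the set of features `S`. -/
def featVec {Ω : Type*} {d : ℕ} (X : Ω → Fin d → ℝ) (S : Set (Fin d)) : Ω → (S → ℝ) :=
  fun ω => S.restrict (X ω)

lemma measurable_featVec {Ω : Type*} [MeasurableSpace Ω] {d : ℕ} {X : Ω → Fin d → ℝ}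
    (hX : Measurable X) (S : Set (Fin d)) : Measurable (featVec X S) :=
  measurable_pi_lambda _ fun i => (measurable_pi_apply (i : Fin d)).comp hX

/-- A set of features `S` is drift inducing iff `T` and `X_{Sᶜ}` are conditionally
independent given `X_S`. -/
def DriftInducing {Ω : Type*} [MeasurableSpace Ω] [StandardBorelSpace Ω] {d : ℕ}
    (μ : Measure Ω) [IsFiniteMeasure μ] (X : Ω → Fin d → ℝ) (hX : Measurable X)
    (T : Ω → ℝ) (S : Set (Fin d)) : Prop :=
  CondIndepFun (MeasurableSpace.comap (featVec X S) inferInstance)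
    ((measurable_featVec hX S).comap_le) T (featVec X Sᶜ) μ

/-- A set of features is minimal drift inducing iff it is drift inducing and no proper
subset of it is drift inducing. -/
def MinimalDriftInducing {Ω : Type*} [MeasurableSpace Ω] [StandardBorelSpace Ω] {d : ℕ}
    (μ : Measure Ω) [IsFiniteMeasure μ] (X : Ω → Fin d → ℝ) (hX : Measurable X)
    (T : Ω → ℝ) (S : Set (Fin d)) : Prop :=
  DriftInducing μ X hX T S ∧ ∀ S' ⊂ S, ¬ DriftInducing μ X hX T S'

/-- A feature `i` is drifting iff there is `R ⊆ Fin d \ {i}` such that `T` and `X_i`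
are not conditionally independent given `X_R`. -/
def DriftingFeature {Ω : Type*} [MeasurableSpace Ω] [StandardBorelSpace Ω] {d : ℕ}
    (μ : Measure Ω) [IsFiniteMeasure μ] (X : Ω → Fin d → ℝ) (hX : Measurable X)
    (T : Ω → ℝ) (i : Fin d) : Prop :=
  ∃ R ⊆ ({i}ᶜ : Set (Fin d)),
    ¬ CondIndepFun (MeasurableSpace.comap (featVec X R) inferInstance)
      ((measurable_featVec hX R).comap_le) T (fun ω => X ω i) μ

/-- A feature `i` is strongly drifting iff `T` and `X_i` are not conditionally
independent given `X_{R_i}` where `R_i = Fin d \ {i}`. -/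
def StronglyDrifting {Ω : Type*} [MeasurableSpace Ω] [StandardBorelSpace Ω] {d : ℕ}
    (μ : Measure Ω) [IsFiniteMeasure μ] (X : Ω → Fin d → ℝ) (hX : Measurable X)
    (T : Ω → ℝ) (i : Fin d) : Prop :=
  ¬ CondIndepFun (MeasurableSpace.comap (featVec X ({i}ᶜ : Set (Fin d))) inferInstance)
    ((measurable_featVec hX _).comap_le) T (fun ω => X ω i) μ

/-- A feature is a drift inducing feature iff it belongs to some minimal drift
inducing set. -/
def DriftInducingFeature {Ω : Type*} [MeasurableSpace Ω] [StandardBorelSpace Ω] {d : ℕ}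
    (μ : Measure Ω) [IsFiniteMeasure μ] (X : Ω → Fin d → ℝ) (hX : Measurable X)
    (T : Ω → ℝ) (i : Fin d) : Prop :=
  ∃ S, MinimalDriftInducing μ X hX T S ∧ i ∈ S

/-- The σ-algebra `m₁ ⊔ m₂` is generated by the intersections of an `m₁`-measurable set with an
`m₂`-measurable set. -/
lemma MeasurableSpace.sup_eq_generateFrom_inter {α : Type*} (m₁ m₂ : MeasurableSpace α) :
    m₁ ⊔ m₂ = MeasurableSpace.generateFrom
      {s | ∃ a b, MeasurableSet[m₁] a ∧ MeasurableSet[m₂] b ∧ a ∩ b = s} := by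
  apply le_antisymm
  · refine sup_le (fun s hs => ?_) (fun s hs => ?_)
    · exact MeasurableSpace.measurableSet_generateFrom
        ⟨s, Set.univ, hs, MeasurableSet.univ, Set.inter_univ s⟩
    · exact MeasurableSpace.measurableSet_generateFrom
        ⟨Set.univ, s, MeasurableSet.univ, hs, Set.univ_inter s⟩
  · refine MeasurableSpace.generateFrom_le ?_
    rintro _ ⟨a, b, ha, hb, rfl⟩
    exact MeasurableSet.inter ((le_sup_left : m₁ ≤ m₁ ⊔ m₂) a ha)
      ((le_sup_right : m₂ ≤ m₁ ⊔ m₂) b hb)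

/-- Two integrable functions with equal integrals over all intersections of an `m₁`-measurable set
with an `m₂`-measurable set have equal integrals over all `m₁ ⊔ m₂`-measurable sets. -/
lemma setIntegral_eq_of_forall_inter {Ω : Type*} {m₁ m₂ : MeasurableSpace Ω}
    [mΩ : MeasurableSpace Ω] {μ : Measure Ω} (hm₁ : m₁ ≤ mΩ) (hm₂ : m₂ ≤ mΩ) {f g : Ω → ℝ}
    (hf : Integrable f μ) (hg : Integrable g μ)
    (h : ∀ a b, MeasurableSet[m₁] a → MeasurableSet[m₂] b →
      ∫ x in a ∩ b, f x ∂μ = ∫ x in a ∩ b, g x ∂μ)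
    {s : Set Ω} (hs : MeasurableSet[m₁ ⊔ m₂] s) :
    ∫ x in s, f x ∂μ = ∫ x in s, g x ∂μ := by
  have hle : m₁ ⊔ m₂ ≤ mΩ := sup_le hm₁ hm₂
  induction s, hs using MeasurableSpace.induction_on_inter
    (MeasurableSpace.sup_eq_generateFrom_inter m₁ m₂) with
  | h_inter =>
    rintro _ ⟨a, b, ha, hb, rfl⟩ _ ⟨a', b', ha', hb', rfl⟩ _
    exact ⟨a ∩ a', b ∩ b', ha.inter ha', hb.inter hb', Set.inter_inter_inter_comm a a' b b'⟩
  | empty => simp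
  | basic t ht =>
    obtain ⟨a, b, ha, hb, rfl⟩ := ht
    exact h a b ha hb
  | compl t ht ih =>
    have huniv := h Set.univ Set.univ MeasurableSet.univ MeasurableSet.univ
    simp only [Set.inter_univ, setIntegral_univ] at huniv
    rw [setIntegral_compl (hle t ht) hf, setIntegral_compl (hle t ht) hg, ih, huniv]
  | iUnion u hd hu ih =>
    rw [integral_iUnion (fun n => hle _ (hu n)) hd hf.integrableOn,
      integral_iUnion (fun n => hle _ (hu n)) hd hg.integrableOn]
    simp_rw [ih]

/-- Pulling an indicator out of a product with a conditional probability. -/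
lemma condExp_condProb_mul_indicator {Ω : Type*} (m : MeasurableSpace Ω)
    [mΩ : MeasurableSpace Ω] (μ : Measure Ω) [IsFiniteMeasure μ] (s : Set Ω) {t : Set Ω} (ht : MeasurableSet t) :
    μ[t.indicator (μ⟦s | m⟧) | m] =ᵐ[μ] μ⟦s | m⟧ * μ⟦t | m⟧ := by
  have heq : t.indicator (μ⟦s | m⟧) = μ⟦s | m⟧ * t.indicator (fun _ => (1 : ℝ)) := by
    ext x
    by_cases hx : x ∈ t <;> simp [hx]
  have hint : Integrable (μ⟦s | m⟧ * t.indicator (fun _ => (1 : ℝ))) μ :=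
    heq ▸ integrable_condExp.indicator ht
  rw [heq]
  exact condExp_mul_of_stronglyMeasurable_left stronglyMeasurable_condExp hint
    ((integrable_const 1).indicator ht)

/-- `m₁` and `m₂` are conditionally independent given `m'` iff conditioning an event of `m₁` on
`m' ⊔ m₂` is the same as conditioning it on `m'`. -/
lemma condIndep_iff_condExp_sup_eq {Ω : Type*} {m' m₁ m₂ : MeasurableSpace Ω}
    [mΩ : MeasurableSpace Ω] [StandardBorelSpace Ω] (μ : Measure Ω) [IsFiniteMeasure μ]
    (hm' : m' ≤ mΩ) (hm₁ : m₁ ≤ mΩ) (hm₂ : m₂ ≤ mΩ) :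
    CondIndep m' m₁ m₂ hm' μ ↔
      ∀ s, MeasurableSet[m₁] s → μ⟦s | m'⟧ =ᵐ[μ] μ⟦s | m' ⊔ m₂⟧ := by
  have hle : m' ⊔ m₂ ≤ mΩ := sup_le hm' hm₂
  have hind : ∀ s, MeasurableSet s → Integrable (s.indicator fun _ => (1 : ℝ)) μ :=
    fun s hs => (integrable_const 1).indicator hs
  rw [condIndep_iff m' m₁ m₂ hm' hm₁ hm₂]
  constructor
  · intro h s hs
    have hmeas : StronglyMeasurable[m' ⊔ m₂] (μ⟦s | m'⟧) :=
      stronglyMeasurable_condExp.mono le_sup_left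
    refine ae_eq_condExp_of_forall_setIntegral_eq hle (hind s (hm₁ s hs))
      (fun _ _ _ => integrable_condExp.integrableOn) (fun t ht _ => ?_)
      hmeas.aestronglyMeasurable
    refine setIntegral_eq_of_forall_inter hm' hm₂ integrable_condExp (hind s (hm₁ s hs))
      (fun a b ha hb => ?_) ht
    have hb' := hm₂ b hb
    have hint : Integrable (b.indicator (μ⟦s | m'⟧)) μ := integrable_condExp.indicator hb'
    calc ∫ x in a ∩ b, (μ⟦s | m'⟧) x ∂μ
        = ∫ x in a, b.indicator (μ⟦s | m'⟧) x ∂μ := (setIntegral_indicator hb').symm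
      _ = ∫ x in a, (μ[b.indicator (μ⟦s | m'⟧) | m']) x ∂μ :=
          (setIntegral_condExp hm' hint ha).symm
      _ = ∫ x in a, (μ⟦s ∩ b | m'⟧) x ∂μ :=
          integral_congr_ae (ae_restrict_of_ae
            ((condExp_condProb_mul_indicator m' μ s hb').trans (h s b hs hb).symm))
      _ = ∫ x in a, (s ∩ b).indicator (fun _ => (1 : ℝ)) x ∂μ :=
          setIntegral_condExp hm' (hind _ ((hm₁ s hs).inter hb')) ha
      _ = ∫ x in a, b.indicator (s.indicator fun _ => (1 : ℝ)) x ∂μ := by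
          rw [Set.indicator_indicator, Set.inter_comm]
      _ = ∫ x in a ∩ b, s.indicator (fun _ => (1 : ℝ)) x ∂μ := setIntegral_indicator hb'
  · intro h s t hs ht
    have hpull : μ⟦s ∩ t | m' ⊔ m₂⟧ =ᵐ[μ] t.indicator (μ⟦s | m'⟧) := by
      have hst : (s ∩ t).indicator (fun _ => (1 : ℝ))
          = t.indicator (s.indicator fun _ => (1 : ℝ)) := by
        rw [Set.indicator_indicator, Set.inter_comm]
      rw [hst]
      refine (condExp_indicator (hind s (hm₁ s hs))
        ((le_sup_right : m₂ ≤ m' ⊔ m₂) t ht)).trans ?_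
      filter_upwards [h s hs] with x hx
      by_cases hxt : x ∈ t <;> simp [hxt, hx]
    calc μ⟦s ∩ t | m'⟧
        =ᵐ[μ] μ[μ⟦s ∩ t | m' ⊔ m₂⟧ | m'] := (condExp_condExp_of_le le_sup_left hle).symm
      _ =ᵐ[μ] μ[t.indicator (μ⟦s | m'⟧) | m'] := condExp_congr_ae hpull
      _ =ᵐ[μ] μ⟦s | m'⟧ * μ⟦t | m'⟧ := condExp_condProb_mul_indicator m' μ s (hm₂ t ht)

section Features

variable {Ω : Type*} {d : ℕ} {X : Ω → Fin d → ℝ} {T : Ω → ℝ}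

lemma comap_featVec (X : Ω → Fin d → ℝ) (S : Set (Fin d)) :
    MeasurableSpace.comap (featVec X S) inferInstance
      = ⨆ i ∈ S, MeasurableSpace.comap (fun ω => X ω i) inferInstance := by
  rw [iSup_subtype']
  exact MeasurableSpace.comap_process_pi (fun (i : S) ω => X ω i)

lemma comap_featVec_mono (X : Ω → Fin d → ℝ) {S R : Set (Fin d)} (h : S ⊆ R) :
    MeasurableSpace.comap (featVec X S) inferInstance
      ≤ MeasurableSpace.comap (featVec X R) inferInstance := by
  rw [comap_featVec, comap_featVec]
  exact biSup_mono h

lemma comap_featVec_sup_compl (X : Ω → Fin d → ℝ) (S : Set (Fin d)) :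
    MeasurableSpace.comap (featVec X S) inferInstance
        ⊔ MeasurableSpace.comap (featVec X Sᶜ) inferInstance
      = MeasurableSpace.comap (featVec X Set.univ) inferInstance := by
  rw [comap_featVec, comap_featVec, comap_featVec, ← iSup_union, Set.union_compl_self]

lemma comap_featVec_sup_comap_apply (X : Ω → Fin d → ℝ) (S : Set (Fin d)) (i : Fin d) :
    MeasurableSpace.comap (featVec X S) inferInstance
        ⊔ MeasurableSpace.comap (fun ω => X ω i) inferInstance
      = MeasurableSpace.comap (featVec X (insert i S)) inferInstance := by
  rw [comap_featVec, comap_featVec, iSup_insert, sup_comm]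

variable [MeasurableSpace Ω] [StandardBorelSpace Ω] {μ : Measure Ω} [IsFiniteMeasure μ]

lemma driftInducing_iff_condExp_eq (hX : Measurable X) (hT : Measurable T) (S : Set (Fin d)) :
    DriftInducing μ X hX T S ↔ ∀ s, MeasurableSet[MeasurableSpace.comap T inferInstance] s →
      μ⟦s | MeasurableSpace.comap (featVec X S) inferInstance⟧
        =ᵐ[μ] μ⟦s | MeasurableSpace.comap (featVec X Set.univ) inferInstance⟧ := by
  rw [DriftInducing, condIndepFun_iff_condIndep, condIndep_iff_condExp_sup_eq μ _ hT.comap_le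
    (measurable_featVec hX _).comap_le, comap_featVec_sup_compl]

lemma condIndepFun_apply_iff_condExp_eq (hX : Measurable X) (hT : Measurable T)
    (R : Set (Fin d)) (i : Fin d) :
    CondIndepFun (MeasurableSpace.comap (featVec X R) inferInstance)
        ((measurable_featVec hX R).comap_le) T (fun ω => X ω i) μ ↔
      ∀ s, MeasurableSet[MeasurableSpace.comap T inferInstance] s →
        μ⟦s | MeasurableSpace.comap (featVec X R) inferInstance⟧
          =ᵐ[μ] μ⟦s | MeasurableSpace.comap (featVec X (insert i R)) inferInstance⟧ := by
  rw [condIndepFun_iff_condIndep, condIndep_iff_condExp_sup_eq μ _ hT.comap_le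
    (measurable_pi_iff.1 hX i).comap_le, comap_featVec_sup_comap_apply]

lemma not_stronglyDrifting_iff (hX : Measurable X) (hT : Measurable T) (i : Fin d) :
    ¬ StronglyDrifting μ X hX T i ↔ DriftInducing μ X hX T {i}ᶜ := by
  rw [StronglyDrifting, not_not, condIndepFun_apply_iff_condExp_eq hX hT,
    driftInducing_iff_condExp_eq hX hT, Set.insert_eq, Set.union_compl_self]

/-- Every superset of a drift inducing set is drift inducing. -/
lemma DriftInducing.mono {hX : Measurable X} (hT : Measurable T) {S R : Set (Fin d)}
    (hS : DriftInducing μ X hX T S) (hSR : S ⊆ R) : DriftInducing μ X hX T R := by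
  rw [driftInducing_iff_condExp_eq hX hT] at hS ⊢
  intro s hs
  have hR := (measurable_featVec hX R).comap_le
  have huniv := (measurable_featVec hX Set.univ).comap_le
  have hfix : μ[μ⟦s | MeasurableSpace.comap (featVec X S) inferInstance⟧ |
      MeasurableSpace.comap (featVec X R) inferInstance]
        = μ⟦s | MeasurableSpace.comap (featVec X S) inferInstance⟧ :=
    condExp_of_stronglyMeasurable hR
      (stronglyMeasurable_condExp.mono (comap_featVec_mono X hSR)) integrable_condExp
  refine (condExp_condExp_of_le (comap_featVec_mono X (Set.subset_univ R)) huniv).symm.trans ?_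
  refine (condExp_congr_ae (hS s hs).symm).trans ?_
  rw [hfix]
  exact hS s hs

/-- A feature that is conditionally independent of `T` given the other features of a drift inducing
set can be removed from that set. -/
lemma DriftInducing.sdiff_singleton {hX : Measurable X} (hT : Measurable T) {S : Set (Fin d)}
    {i : Fin d} (hS : DriftInducing μ X hX T S) (hi : i ∈ S)
    (hci : CondIndepFun (MeasurableSpace.comap (featVec X (S \ {i})) inferInstance)
      ((measurable_featVec hX _).comap_le) T (fun ω => X ω i) μ) :
    DriftInducing μ X hX T (S \ {i}) := by
  rw [condIndepFun_apply_iff_condExp_eq hX hT, Set.insert_sdiff_singleton,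
    Set.insert_eq_of_mem hi] at hci
  rw [driftInducing_iff_condExp_eq hX hT] at hS ⊢
  exact fun s hs => (hci s hs).trans (hS s hs)

end Features

/-- Every drift inducing feature is strongly drift inducing iff every weakly drifting
feature is faithfully drifting. -/
theorem wellSuited_iff {Ω : Type*} [MeasurableSpace Ω] [StandardBorelSpace Ω] {d : ℕ}
    (μ : Measure Ω) [IsProbabilityMeasure μ] (X : Ω → Fin d → ℝ) (hX : Measurable X)
    (T : Ω → ℝ) (hT : Measurable T) :
    (∀ i : Fin d, DriftInducingFeature μ X hX T i →
        ∀ S : Set (Fin d), DriftInducing μ X hX T S → i ∈ S)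
      ↔ ∀ i : Fin d, DriftingFeature μ X hX T i → ¬ StronglyDrifting μ X hX T i →
          ¬ DriftInducingFeature μ X hX T i := by
  constructor
  · intro h i _ hns hi
    rw [not_stronglyDrifting_iff hX hT] at hns
    exact h i hi _ hns rfl
  · rintro h i ⟨S, ⟨hS, hmin⟩, hiS⟩ S' hS'
    by_contra hiS'
    have hns : ¬ StronglyDrifting μ X hX T i :=
      (not_stronglyDrifting_iff hX hT i).2
        (hS'.mono hT (Set.subset_compl_singleton_iff.2 hiS'))
    refine h i ⟨S \ {i}, fun _ hx => hx.2, fun hci => ?_⟩ hns ⟨S, ⟨hS, hmin⟩, hiS⟩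
    exact hmin _ (Set.sdiff_singleton_ssubset.2 hiS) (hS.sdiff_singleton hT hiS hci)
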